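/- Let δ > 0, L, N > 0, let X be a δ-hyperbolic length space, and let G act by isometries on X with the action (100δ, L, N)-acylindrical. Then the injectivity radius of G on X is bounded below by δ/N, i.e. every loxodromic element g ∈ G satisfies [g]_∞ ≥ δ/N. -/

import Mathlib

open scoped Classical

noncomputable section

universe u u' v w v' w'

/-! ## Words over an alphabet -/

/-- A word over the alphabet `S`: a list of letters together with exponents `±1`. -/
abbrev Word (S : Type u) := List (S × Bool)

namespace Word

variable {S : Type u}

/-- The formal inverse of a word. -/
def inv (w : Word S) : Word S := (w.map fun a => (a.1, !a.2)).reverse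

/-- A word is reduced if it contains no cancelling adjacent pair. -/
def IsReduced (w : Word S) : Prop :=
  List.Chain' (fun a b => ¬(a.1 = b.1 ∧ b.2 = !a.2)) w

/-- A word is cyclically reduced if its square is reduced. -/
def IsCyclicallyReduced (w : Word S) : Prop := IsReduced (w ++ w)

/-- `c` is a cyclic conjugate of `w` if it is obtained from `w` by rotation. -/
def IsCyclicConjugate (w c : Word S) : Prop := ∃ k, c = w.rotate k

/-- The `k`-th power of a word. -/
def pow (w : Word S) : ℕ → Word S
  | 0 => []
  | k + 1 => w ++ pow w k

end Word

/-! ## Burnside quotients, bundled groups and word metrics -/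

/-- The (normal) subgroup of `G` generated by all `n`-th powers. -/
def powerSubgroup (G : Type v) [Group G] (n : ℕ) : Subgroup G :=
  Subgroup.normalClosure { g : G | ∃ x : G, g = x ^ n }

instance powerSubgroup_normal (G : Type v) [Group G] (n : ℕ) :
    (powerSubgroup G n).Normal :=
  Subgroup.normalClosure_normal

/-- The quotient `G/G^n` of `G` by the normal subgroup generated by `n`-th powers. -/
abbrev BurnsideQuotient (G : Type v) [Group G] (n : ℕ) : Type v :=
  G ⧸ powerSubgroup G n

/-- A bundled group. -/
structure GrpB : Type 1 where
  carrier : Type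
  [str : Group carrier]

attribute [instance] GrpB.str

instance : CoeSort GrpB Type := ⟨GrpB.carrier⟩

def GrpB.of (G : Type) [Group G] : GrpB := ⟨G⟩

/-- The word metric on a group `G` associated with a (symmetrized) generating set `A`. -/
def wordDist {G : Type v} [Group G] (A : Set G) (g h : G) : ℝ :=
  sInf { r : ℝ | ∃ l : List G, (∀ a ∈ l, a ∈ A ∨ a⁻¹ ∈ A) ∧ g⁻¹ * h = l.prod ∧
    r = l.length }

/-- The left multiplication action of a group on itself. -/
def leftTransl {G : Type v} [Group G] : G → G → G := fun g x => g * x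

/-! ## Labelled graphs (graphs in the sense of Serre with labelling) -/

structure LabGraph (S : Type u) where
  /-- vertices -/
  V : Type v
  /-- (oriented) edges -/
  E : Type w
  /-- initial vertex -/
  init : E → V
  /-- inversion of edges -/
  bar : E → E
  bar_ne : ∀ e, bar e ≠ e
  bar_bar : ∀ e, bar (bar e) = e
  /-- labelling by `S ⊔ S⁻¹` -/
  label : E → S × Bool
  label_bar_fst : ∀ e, (label (bar e)).1 = (label e).1
  label_bar_snd : ∀ e, (label (bar e)).2 = !(label e).2

namespace LabGraph

variable {S : Type u}

/-- terminal vertex of an edge -/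
def term (Γ : LabGraph S) (e : Γ.E) : Γ.V := Γ.init (Γ.bar e)

/-- A path is a list of consecutive edges. -/
def IsPath (Γ : LabGraph S) (p : List Γ.E) : Prop :=
  List.Chain' (fun e f => Γ.term e = Γ.init f) p

def firstV (Γ : LabGraph S) (p : List Γ.E) : Option Γ.V := p.head?.map Γ.init

def lastV (Γ : LabGraph S) (p : List Γ.E) : Option Γ.V := p.getLast?.map Γ.term

def IsPathFrom (Γ : LabGraph S) (u v : Γ.V) (p : List Γ.E) : Prop :=
  Γ.IsPath p ∧ ((p = [] ∧ u = v) ∨ (Γ.firstV p = some u ∧ Γ.lastV p = some v))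

def IsClosedPath (Γ : LabGraph S) (p : List Γ.E) : Prop :=
  Γ.IsPath p ∧ p ≠ [] ∧ Γ.firstV p = Γ.lastV p

/-- A simple closed path: a closed path visiting no vertex twice. -/
def IsSimpleClosedPath (Γ : LabGraph S) (p : List Γ.E) : Prop :=
  Γ.IsClosedPath p ∧ (p.map Γ.init).Nodup

/-- The label of a path. -/
def wordOf (Γ : LabGraph S) (p : List Γ.E) : Word S := p.map Γ.label

def LabelsPath (Γ : LabGraph S) (w : Word S) : Prop :=
  ∃ p, Γ.IsPath p ∧ Γ.wordOf p = w

def LabelsClosedPath (Γ : LabGraph S) (w : Word S) : Prop :=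
  ∃ p, Γ.IsClosedPath p ∧ Γ.wordOf p = w

def Adj (Γ : LabGraph S) (u v : Γ.V) : Prop := ∃ e, Γ.init e = u ∧ Γ.term e = v

/-- Two vertices are in the same connected component iff they are reachable. -/
def Reachable (Γ : LabGraph S) : Γ.V → Γ.V → Prop := Relation.ReflTransGen Γ.Adj

/-- Label-preserving automorphisms of a labelled graph. -/
structure Aut (Γ : LabGraph S) where
  vmap : Γ.V ≃ Γ.V
  emap : Γ.E ≃ Γ.E
  init_comm : ∀ e, Γ.init (emap e) = vmap (Γ.init e)
  bar_comm : ∀ e, Γ.bar (emap e) = emap (Γ.bar e)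
  label_comm : ∀ e, Γ.label (emap e) = Γ.label e

/-- Label-preserving graph homomorphisms. -/
structure Hom (Γ : LabGraph.{u, v, w} S) (Δ : LabGraph.{u, v', w'} S) where
  vmap : Γ.V → Δ.V
  emap : Γ.E → Δ.E
  init_comm : ∀ e, Δ.init (emap e) = vmap (Γ.init e)
  bar_comm : ∀ e, Δ.bar (emap e) = emap (Γ.bar e)
  label_comm : ∀ e, Δ.label (emap e) = Γ.label e

/-- The connected component of `v₀`, as a labelled graph. -/
def component (Γ : LabGraph S) (v₀ : Γ.V) : LabGraph S where
  V := { v : Γ.V // Γ.Reachable v₀ v }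
  E := { e : Γ.E // Γ.Reachable v₀ (Γ.init e) }
  init e := ⟨Γ.init e.1, e.2⟩
  bar e := ⟨Γ.bar e.1, e.2.tail ⟨e.1, rfl, rfl⟩⟩
  bar_ne e h := Γ.bar_ne e.1 (congrArg Subtype.val h)
  bar_bar e := Subtype.ext (Γ.bar_bar e.1)
  label e := Γ.label e.1
  label_bar_fst e := Γ.label_bar_fst e.1
  label_bar_snd e := Γ.label_bar_snd e.1

/-- A piece: a word labelling two paths of `Γ` which are not identified by any
label-preserving automorphism of `Γ`. -/
def IsPiece (Γ : LabGraph S) (w : Word S) : Prop :=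
  ∃ p₁ p₂ : List Γ.E, Γ.IsPath p₁ ∧ Γ.IsPath p₂ ∧ Γ.wordOf p₁ = w ∧ Γ.wordOf p₂ = w ∧
    ∀ φ : Γ.Aut, p₂ ≠ p₁.map ⇑φ.emap

/-- A labelled graph is reduced if no two distinct edges with the same initial vertex
carry the same label. -/
def Reduced (Γ : LabGraph S) : Prop :=
  ∀ e₁ e₂ : Γ.E, Γ.init e₁ = Γ.init e₂ → Γ.label e₁ = Γ.label e₂ → e₁ = e₂

/-- `w` occurs on the (closed) path `γ`: it labels a subpath of some rotation of `γ`. -/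
def OccursOn (Γ : LabGraph S) (w : Word S) (γ : List Γ.E) : Prop :=
  ∃ k, w <:+: Γ.wordOf (γ.rotate k)

/-- The graphical `C'(λ)` small cancellation condition. -/
def GrSC (Γ : LabGraph S) (lam : ℝ) : Prop :=
  Γ.Reduced ∧
  ∀ γ, Γ.IsSimpleClosedPath γ → ∀ w, Γ.IsPiece w → Γ.OccursOn w γ →
    (w.length : ℝ) < lam * (γ.length : ℝ)

/-- Strongly reduced: no loops, and no closed path labelled `s t⁻¹` for `s ≠ t`. -/
def StronglyReduced (Γ : LabGraph S) : Prop :=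
  (∀ e : Γ.E, Γ.init e ≠ Γ.term e) ∧
  ∀ s t : S, s ≠ t → ¬ Γ.LabelsClosedPath [(s, true), (t, false)]

/-- The graphical `C'_n(λ, p)`-condition of Coulon–Gruber. -/
def GrSCB (Γ : LabGraph S) (n : ℕ) (lam : ℝ) (p : ℕ) : Prop :=
  Γ.StronglyReduced ∧ Γ.GrSC lam ∧
  ∀ w : Word S, Word.IsCyclicallyReduced w → Γ.LabelsPath (Word.pow w p) →
    Γ.LabelsClosedPath (Word.pow w n)

/-- The graphical `C'(λ, p)`-condition: `C'(λ)` and any `p`-th power of a cyclically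
reduced word read on `Γ` has all its powers read on `Γ`. -/
def GrSCP (Γ : LabGraph S) (lam : ℝ) (p : ℕ) : Prop :=
  Γ.GrSC lam ∧
  ∀ w : Word S, Word.IsCyclicallyReduced w → Γ.LabelsPath (Word.pow w p) →
    ∀ k : ℕ, Γ.LabelsPath (Word.pow w k)

/-- The relations of `G(Γ)`: labels of closed paths of `Γ`. -/
def rels (Γ : LabGraph S) : Set (FreeGroup S) :=
  { g | ∃ p, Γ.IsClosedPath p ∧ g = FreeGroup.mk (Γ.wordOf p) }

/-- The group `G(Γ)` defined by the labelled graph `Γ`. -/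
abbrev Grp (Γ : LabGraph S) : Type u :=
  FreeGroup S ⧸ Subgroup.normalClosure Γ.rels

/-- Evaluation of a word in `G(Γ)`. -/
def evalWord (Γ : LabGraph S) (w : Word S) : Γ.Grp :=
  QuotientGroup.mk (FreeGroup.mk w)

/-- The canonical generators of `G(Γ)`. -/
def gen (Γ : LabGraph S) : S → Γ.Grp := fun s => Γ.evalWord [(s, true)]

/-- The Burnside quotient `G_n(Γ) = G(Γ)/G(Γ)ⁿ`. -/
abbrev GrpN (Γ : LabGraph S) (n : ℕ) : Type u := BurnsideQuotient Γ.Grp n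

/-- The canonical generators of `G_n(Γ)`. -/
def genN (Γ : LabGraph S) (n : ℕ) : S → Γ.GrpN n :=
  fun s => QuotientGroup.mk (Γ.gen s)

/-- The generating set `S ∪ W` of the cone-off space: the canonical generators together
with all elements of `G(Γ)` represented by labels of paths in `Γ`. -/
def coneGens (Γ : LabGraph S) : Set Γ.Grp :=
  Set.range Γ.gen ∪ { g | ∃ p, Γ.IsPath p ∧ g = Γ.evalWord (Γ.wordOf p) }

/-- The metric of the cone-off space `Ẋ(Γ)`: the word metric on `G(Γ)` with respect to
`S ∪ W`. -/
def coneDist (Γ : LabGraph S) : Γ.Grp → Γ.Grp → ℝ := wordDist Γ.coneGens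

def EveryGeneratorOccurs (Γ : LabGraph S) : Prop :=
  ∀ s : S, ∃ e : Γ.E, (Γ.label e).1 = s

def NoIsolatedVertex (Γ : LabGraph S) : Prop := ∀ v : Γ.V, ∃ e : Γ.E, Γ.init e = v

/-- The `m`-th iterate of an automorphism is the identity. -/
def AutPowId (Γ : LabGraph S) (φ : Γ.Aut) (m : ℕ) : Prop :=
  (∀ v, (⇑φ.vmap)^[m] v = v) ∧ (∀ e, (⇑φ.emap)^[m] e = e)

/-- The automorphism `φ` has order exactly `m`. -/
def AutOrder (Γ : LabGraph S) (φ : Γ.Aut) (m : ℕ) : Prop :=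
  Γ.AutPowId φ m ∧ ∀ k, 0 < k → k < m → ¬ Γ.AutPowId φ k

end LabGraph

/-- An automorphism is the identity. -/
def IsAutId {S : Type u} {Γ : LabGraph S} (φ : Γ.Aut) : Prop :=
  (∀ v, φ.vmap v = v) ∧ (∀ e, φ.emap e = e)

/-- The Cayley graph of a group `G` with respect to a family of generators `σ : S → G`,
as a labelled graph. -/
def CayleyGraph (G : Type v) [Group G] (S : Type u) (σ : S → G) : LabGraph S where
  V := G
  E := G × S × Bool
  init e := e.1
  bar e := (e.1 * (if e.2.2 then σ e.2.1 else (σ e.2.1)⁻¹), e.2.1, !e.2.2)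
  bar_ne e h := by
    have h2 := congrArg (fun x => x.2.2) h
    simp at h2
  bar_bar e := by
    obtain ⟨g, s, b⟩ := e
    cases b <;> simp
  label e := e.2
  label_bar_fst _ := rfl
  label_bar_snd _ := rfl

/-- Relabelling of a labelled graph along a map of alphabets. -/
def LabGraph.relabel {S : Type u} {T : Type u'} (Γ : LabGraph S) (f : S → T) :
    LabGraph T where
  V := Γ.V
  E := Γ.E
  init := Γ.init
  bar := Γ.bar
  bar_ne := Γ.bar_ne
  bar_bar := Γ.bar_bar
  label e := (f (Γ.label e).1, (Γ.label e).2)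
  label_bar_fst e := congrArg f (Γ.label_bar_fst e)
  label_bar_snd e := Γ.label_bar_snd e

/-- Every connected component of `Γ` embeds into `Δ` by a label-preserving graph
homomorphism (which can be chosen to send a base vertex to any prescribed vertex). -/
def ComponentsEmbed {S : Type u} (Γ : LabGraph.{u, v, w} S)
    (Δ : LabGraph.{u, v', w'} S) : Prop :=
  ∀ (v₀ : Γ.V) (x : Δ.V), ∃ f : LabGraph.Hom Γ Δ, f.vmap v₀ = x ∧
    Set.InjOn f.vmap { u | Γ.Reachable v₀ u } ∧
    Set.InjOn f.emap { e | Γ.Reachable v₀ (Γ.init e) }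

/-- The path metric on (the vertices of) a labelled graph. -/
def graphDist {S : Type u} (Γ : LabGraph S) (u v : Γ.V) : ℝ :=
  sInf { r : ℝ | ∃ p, Γ.IsPathFrom u v p ∧ r = p.length }

/-- Diameter of the connected component of `v`. -/
def compDiam {S : Type u} (Γ : LabGraph S) (v : Γ.V) : ℝ :=
  sSup { r : ℝ | ∃ u w, Γ.Reachable v u ∧ Γ.Reachable v w ∧ r = graphDist Γ u w }

/-- An indexing of the connected components of `Γ` by natural numbers. -/
def LabGraph.IsComponentIndex {S : Type u} (Γ : LabGraph S) (idx : Γ.V → ℕ) : Prop :=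
  ∀ u v, Γ.Reachable u v ↔ idx u = idx v

/-- The box-space metric on a labelled graph whose components are indexed by `idx`. -/
def LabGraph.boxDist {S : Type u} (Γ : LabGraph S) (idx : Γ.V → ℕ) (u v : Γ.V) : ℝ :=
  if Γ.Reachable u v then graphDist Γ u v
  else compDiam Γ u + compDiam Γ v + (idx u : ℝ) + (idx v : ℝ)

/-- Coarse embeddings between spaces endowed with distance functions, via the sequence
characterisation. -/
def IsCoarseEmbeddingWith {A : Type v} {B : Type w} (dA : A → A → ℝ) (dB : B → B → ℝ)
    (f : A → B) : Prop :=
  ∀ x y : ℕ → A,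
    (Filter.Tendsto (fun k => dA (x k) (y k)) Filter.atTop Filter.atTop ↔
      Filter.Tendsto (fun k => dB (f (x k)) (f (y k))) Filter.atTop Filter.atTop)

/-- Distance between two subsets. -/
def setDist {Y : Type v} (ρ : Y → Y → ℝ) (A B : Set Y) : ℝ :=
  sInf { r : ℝ | ∃ a ∈ A, ∃ b ∈ B, r = ρ a b }

/-! ## Hyperbolicity, boundary and group actions, relative to a distance function -/

/-- The Gromov product. -/
def gromovProd {Y : Type v} (ρ : Y → Y → ℝ) (x y t : Y) : ℝ :=
  (ρ x t + ρ y t - ρ x y) / 2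

/-- `δ`-hyperbolicity via the four point condition. -/
def IsHyperbolicDist {Y : Type v} (ρ : Y → Y → ℝ) (δ : ℝ) : Prop :=
  ∀ x y z t : Y, min (gromovProd ρ x y t) (gromovProd ρ y z t) - δ ≤ gromovProd ρ x z t

/-- Length space (via approximate midpoints). -/
def IsLengthDist {Y : Type v} (ρ : Y → Y → ℝ) : Prop :=
  ∀ x y : Y, ∀ ε : ℝ, 0 < ε → ∃ m : Y, ρ x m ≤ ρ x y / 2 + ε ∧ ρ m y ≤ ρ x y / 2 + ε

/-- A sequence converges at infinity if its Gromov products tend to infinity. -/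
def ConvergesAtInfinity {Y : Type v} (ρ : Y → Y → ℝ) (b : Y) (u : ℕ → Y) : Prop :=
  ∀ M : ℝ, ∃ K : ℕ, ∀ i j : ℕ, K ≤ i → K ≤ j → M ≤ gromovProd ρ (u i) (u j) b

/-- Two sequences converging at infinity define the same boundary point. -/
def EquivAtInfinity {Y : Type v} (ρ : Y → Y → ℝ) (b : Y) (u v : ℕ → Y) : Prop :=
  ∀ M : ℝ, ∃ K : ℕ, ∀ i j : ℕ, K ≤ i → K ≤ j → M ≤ gromovProd ρ (u i) (v j) b

section GroupAction

variable {G : Type v} [Group G] {Y : Type w}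

/-- An element is elliptic if it has a bounded orbit. -/
def EllipticElt (ρ : Y → Y → ℝ) (act : G → Y → Y) (g : G) : Prop :=
  ∃ (x : Y) (C : ℝ), ∀ k : ℤ, ρ (act (g ^ k) x) x ≤ C

/-- A set of group elements is elliptic if it has a bounded orbit. -/
def EllipticSet (ρ : Y → Y → ℝ) (act : G → Y → Y) (H : Set G) : Prop :=
  ∃ (x : Y) (C : ℝ), ∀ h ∈ H, ρ (act h x) x ≤ C

/-- An element is loxodromic (hyperbolic) if `m ↦ gᵐ • x` is a quasi-isometric
embedding of `ℤ`. -/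
def LoxodromicElt (ρ : Y → Y → ℝ) (act : G → Y → Y) (g : G) : Prop :=
  ∃ (x : Y) (lam c : ℝ), 0 < lam ∧ 0 ≤ c ∧ ∀ m n : ℤ,
    lam⁻¹ * |(m : ℝ) - (n : ℝ)| - c ≤ ρ (act (g ^ m) x) (act (g ^ n) x) ∧
    ρ (act (g ^ m) x) (act (g ^ n) x) ≤ lam * |(m : ℝ) - (n : ℝ)| + c

/-- The action is non-elementary: the limit set of an orbit contains at least three
points of the Gromov boundary. -/
def NonElementaryOn (ρ : Y → Y → ℝ) (act : G → Y → Y) : Prop :=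
  ∃ (b : Y) (u₁ u₂ u₃ : ℕ → G),
    ConvergesAtInfinity ρ b (fun k => act (u₁ k) b) ∧
    ConvergesAtInfinity ρ b (fun k => act (u₂ k) b) ∧
    ConvergesAtInfinity ρ b (fun k => act (u₃ k) b) ∧
    ¬ EquivAtInfinity ρ b (fun k => act (u₁ k) b) (fun k => act (u₂ k) b) ∧
    ¬ EquivAtInfinity ρ b (fun k => act (u₁ k) b) (fun k => act (u₃ k) b) ∧
    ¬ EquivAtInfinity ρ b (fun k => act (u₂ k) b) (fun k => act (u₃ k) b)

/-- A `(d, L, N)`-acylindrical action. -/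
def AcylindricalOn (ρ : Y → Y → ℝ) (act : G → Y → Y) (d L : ℝ) (N : ℕ) : Prop :=
  ∀ x y : Y, L ≤ ρ x y →
    { u : G | ρ (act u x) x ≤ d ∧ ρ (act u y) y ≤ d }.Finite ∧
    { u : G | ρ (act u x) x ≤ d ∧ ρ (act u y) y ≤ d }.ncard ≤ N

/-- A lineal subgroup: the limit set of its orbit consists of exactly two points. -/
def LinealSubgroup (ρ : Y → Y → ℝ) (act : G → Y → Y) (H : Subgroup G) : Prop :=
  ∃ (b : Y) (u v : ℕ → G), (∀ k, u k ∈ H) ∧ (∀ k, v k ∈ H) ∧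
    ConvergesAtInfinity ρ b (fun k => act (u k) b) ∧
    ConvergesAtInfinity ρ b (fun k => act (v k) b) ∧
    ¬ EquivAtInfinity ρ b (fun k => act (u k) b) (fun k => act (v k) b) ∧
    ∀ w : ℕ → G, (∀ k, w k ∈ H) → ConvergesAtInfinity ρ b (fun k => act (w k) b) →
      (EquivAtInfinity ρ b (fun k => act (w k) b) (fun k => act (u k) b) ∨
        EquivAtInfinity ρ b (fun k => act (w k) b) (fun k => act (v k) b))

/-- A maximal lineal subgroup. -/
def MaximalLineal (ρ : Y → Y → ℝ) (act : G → Y → Y) (E : Subgroup G) : Prop :=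
  LinealSubgroup ρ act E ∧
  ∀ E' : Subgroup G, LinealSubgroup ρ act E' → E ≤ E' → E = E'

/-- `F` is the maximal finite normal subgroup of `E`. -/
def MaxFiniteNormalIn (F E : Subgroup G) : Prop :=
  F ≤ E ∧ (F : Set G).Finite ∧ (∀ g ∈ E, ∀ f ∈ F, g * f * g⁻¹ ∈ F) ∧
  ∀ F' : Subgroup G, F' ≤ E → (F' : Set G).Finite →
    (∀ g ∈ E, ∀ f ∈ F', g * f * g⁻¹ ∈ F') → F' ≤ F

end GroupAction

/-- The exponent of the holomorph `Hol(H) = H ⋊ Aut(H)`. -/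
def holExponent (H : Type v) [Group H] : ℕ :=
  Monoid.exponent (SemidirectProduct H (MulAut H) (MonoidHom.id (MulAut H)))

/-- `e` is the least common multiple of the exponents of the holomorphs of the maximal
finite normal subgroups of the maximal lineal subgroups (the invariant `e(G, X)`). -/
def IsHolLcm {G : Type v} [Group G] {Y : Type w} (ρ : Y → Y → ℝ) (act : G → Y → Y)
    (e : ℕ) : Prop :=
  (∀ E F : Subgroup G, MaximalLineal ρ act E → MaxFiniteNormalIn F E →
    holExponent ↥F ∣ e) ∧
  ∀ m : ℕ, (∀ E F : Subgroup G, MaximalLineal ρ act E → MaxFiniteNormalIn F E →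
    holExponent ↥F ∣ m) → e ∣ m

/-! ## Relators, geodesic sequences and parallelism -/

/-- A relator: the embedded image of a connected component of `Γ` in `Δ` under a
label-preserving graph homomorphism. -/
def IsRelatorIn {S : Type u} (Γ : LabGraph.{u, v, w} S) (Δ : LabGraph.{u, v', w'} S)
    (R : Set Δ.V) : Prop :=
  ∃ (f : LabGraph.Hom Γ Δ) (v₀ : Γ.V),
    Set.InjOn f.vmap { u | Γ.Reachable v₀ u } ∧
    R = f.vmap '' { u | Γ.Reachable v₀ u }

/-- A chain of relators with consecutive nonempty intersections. -/
def IsRelChain {S : Type u} (Γ : LabGraph.{u, v, w} S) (Δ : LabGraph.{u, v', w'} S)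
    (c : List (Set Δ.V)) : Prop :=
  (∀ R ∈ c, IsRelatorIn Γ Δ R) ∧ List.Chain' (fun R T => (R ∩ T).Nonempty) c

/-- A geodesic sequence of relators. -/
def IsGeoSeq {S : Type u} (Γ : LabGraph.{u, v, w} S) (Δ : LabGraph.{u, v', w'} S)
    (c : List (Set Δ.V)) : Prop :=
  IsRelChain Γ Δ c ∧ c ≠ [] ∧
  ∀ c' : List (Set Δ.V), IsRelChain Γ Δ c' → c'.head? = c.head? →
    c'.getLast? = c.getLast? → c.length ≤ c'.length

/-- Two sequences of relators are parallel. -/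
def AreParallel {V : Type v} (c d : List (Set V)) : Prop :=
  c.length = d.length ∧
  ∀ (i : ℕ) (hi : i < c.length) (hj : i < d.length),
    (c.get ⟨i, hi⟩ ∩ d.get ⟨i, hj⟩).Nonempty

/-- Conclusion of the parallelism proposition: truncations by at most `9ε + 3` terms of
the two sequences are parallel. -/
def ParallelTruncation {V : Type v} (c d : List (Set V)) (ε : ℝ) : Prop :=
  ∃ k k' l l' : ℕ, 1 ≤ k ∧ 1 ≤ k' ∧ 1 ≤ l ∧ 1 ≤ l' ∧
    (k : ℝ) ≤ 9 * ε + 3 ∧ (k' : ℝ) ≤ 9 * ε + 3 ∧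
    (l : ℝ) ≤ 9 * ε + 3 ∧ (l' : ℝ) ≤ 9 * ε + 3 ∧
    k + l = k' + l' ∧
    AreParallel ((c.drop (k - 1)).take (c.length + 2 - l - k))
      ((d.drop (k' - 1)).take (d.length + 2 - l' - k'))

/-- The conclusions of the chord lemma for cyclic configurations of 3 and 4 relators. -/
def ChordProperty {V : Type v} (Rel : Set V → Prop) : Prop :=
  (∀ R₁ R₂ R₃, Rel R₁ → Rel R₂ → Rel R₃ →
    (R₁ ∩ R₂).Nonempty → (R₂ ∩ R₃).Nonempty → (R₃ ∩ R₁).Nonempty →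
    (R₁ ∩ R₂ ∩ R₃).Nonempty) ∧
  (∀ R₁ R₂ R₃ R₄, Rel R₁ → Rel R₂ → Rel R₃ → Rel R₄ →
    (R₁ ∩ R₂).Nonempty → (R₂ ∩ R₃).Nonempty → (R₃ ∩ R₄).Nonempty → (R₄ ∩ R₁).Nonempty →
    (R₁ ∩ R₃).Nonempty ∨ (R₂ ∩ R₄).Nonempty)

/-- The union of a sequence of sets of vertices is convex: any geodesic between two of
its vertices stays inside the union. -/
def ConvexUnion {S : Type u} (Δ : LabGraph S) (c : List (Set Δ.V)) : Prop :=
  ∀ u v : Δ.V, (∃ R ∈ c, u ∈ R) → (∃ R ∈ c, v ∈ R) →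
    ∀ p : List Δ.E, Δ.IsPathFrom u v p → (p.length : ℝ) = graphDist Δ u v →
      ∀ e ∈ p, (∃ R ∈ c, Δ.init e ∈ R) ∧ (∃ R ∈ c, Δ.term e ∈ R)

/-! ## Classical small cancellation -/

/-- A classical piece: a common prefix of two distinct cyclic conjugates of elements of
`R ∪ R⁻¹`. -/
def IsClassicalPiece {S : Type u} (R : Set (Word S)) (u : Word S) : Prop :=
  ∃ c₁ c₂ : Word S, c₁ ≠ c₂ ∧
    (∃ r ∈ R, Word.IsCyclicConjugate r c₁ ∨ Word.IsCyclicConjugate (Word.inv r) c₁) ∧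
    (∃ r ∈ R, Word.IsCyclicConjugate r c₂ ∨ Word.IsCyclicConjugate (Word.inv r) c₂) ∧
    u <+: c₁ ∧ u <+: c₂

/-- The classical `C'(λ)` small cancellation condition. -/
def ClassicalSC {S : Type u} (R : Set (Word S)) (lam : ℝ) : Prop :=
  (∀ r ∈ R, Word.IsCyclicallyReduced r) ∧
  ∀ u, IsClassicalPiece R u → ∀ r ∈ R, ∀ c, Word.IsCyclicConjugate r c → u <:+: c →
    (u.length : ℝ) < lam * (r.length : ℝ)

/-! ## Free products: syllables and classical small cancellation over free products -/

section FreeProducts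

variable {ι : Type u} (M : ι → Type v) [∀ i, Group (M i)]

open Monoid

/-- The list of syllables of the normal form of an element of a free product. -/
def sylList (g : CoprodI M) : List (Σ i, M i) := by
  classical exact (CoprodI.Word.equiv (M := M) g).toList

/-- The syllable length `|g|_*` of an element of a free product. -/
def sylLen (g : CoprodI M) : ℕ := (sylList M g).length

/-- The product `g * h` is weakly reduced. -/
def WeaklyRedProd (g h : CoprodI M) : Prop :=
  sylLen M g + sylLen M h ≤ sylLen M (g * h) + 1

/-- `g` is cyclically reduced: syllable length at most one, or first and last syllables
in distinct factors. -/
def CyclRed (g : CoprodI M) : Prop :=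
  sylLen M g ≤ 1 ∨
    (sylList M g).head?.map Sigma.fst ≠ (sylList M g).getLast?.map Sigma.fst

/-- `g` is weakly cyclically reduced: syllable length at most one, or the product of the
last and first syllables does not vanish. -/
def WeaklyCyclRed (g : CoprodI M) : Prop :=
  sylLen M g ≤ 1 ∨ ∀ (i : ι) (a b : M i),
    (sylList M g).getLast? = some ⟨i, a⟩ → (sylList M g).head? = some ⟨i, b⟩ →
      a * b ≠ 1

/-- `c` is a weakly cyclic conjugate of `r`. -/
def WeakCyclConj (r c : CoprodI M) : Prop :=
  ∃ u v : CoprodI M, r = u * v ∧ WeaklyRedProd M u v ∧ c = v * u ∧ WeaklyCyclRed M c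

/-- A symmetrized subset of a free product. -/
def Symmetrized (R : Set (CoprodI M)) : Prop :=
  (∀ r ∈ R, CyclRed M r) ∧
  ∀ r ∈ R, ∀ c, (WeakCyclConj M r c ∨ WeakCyclConj M r⁻¹ c) → c ∈ R

/-- A piece for free product small cancellation. -/
def FPPiece (R : Set (CoprodI M)) (u : CoprodI M) : Prop :=
  ∃ r₁ ∈ R, ∃ r₂ ∈ R, r₁ ≠ r₂ ∧
    ∃ v₁ v₂ : CoprodI M, r₁ = u * v₁ ∧ WeaklyRedProd M u v₁ ∧
      r₂ = u * v₂ ∧ WeaklyRedProd M u v₂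

/-- The power-free `C'_*(λ)` small cancellation condition over a free product. -/
def PowerFreeSC (R : Set (CoprodI M)) (lam : ℝ) : Prop :=
  (∀ r ∈ R, ∀ u v : CoprodI M, r = u * v → WeaklyRedProd M u v → FPPiece M R u →
    (sylLen M u : ℝ) < lam * (sylLen M r : ℝ)) ∧
  (∀ r ∈ R, 1 / lam < (sylLen M r : ℝ)) ∧
  (∀ r ∈ R, ¬ ∃ (x : CoprodI M) (k : ℕ), 2 ≤ k ∧ r = x ^ k)

/-- The power-free `C'_*(λ, p)` small cancellation condition over a free product. -/
def PowerFreeSCP (R : Set (CoprodI M)) (lam : ℝ) (p : ℕ) : Prop :=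
  PowerFreeSC M R lam ∧
  ∀ r ∈ R, ∀ (w v : CoprodI M) (k : ℕ), CyclRed M w → 1 < sylLen M w →
    r = w ^ k * v → WeaklyRedProd M (w ^ k) v → k ≤ p

end FreeProducts

/-! ## Graphical small cancellation over free products -/

section FPGraphical

variable {ι : Type u} (M : ι → Type v) [∀ i, Group (M i)] (S : ι → Type u')
  (σ : ∀ i, S i → M i)

open Monoid

/-- The image in the free product of a letter of a word over `Σ i, S i`. -/
def letterFP (x : (Σ i, S i) × Bool) : CoprodI M :=
  if x.2 = true then CoprodI.of (σ x.1.1 x.1.2)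
  else (CoprodI.of (σ x.1.1 x.1.2))⁻¹

/-- Evaluation of a word in the free product. -/
def evalFPWord (w : Word (Σ i, S i)) : CoprodI M :=
  (w.map (letterFP M S σ)).prod

/-- The relations of `G(Γ)` over the free product. -/
def fpRels (Γ : LabGraph (Σ i, S i)) : Set (CoprodI M) :=
  { g | ∃ p, Γ.IsClosedPath p ∧ g = evalFPWord M S σ (Γ.wordOf p) }

/-- The group defined by a labelled graph over a free product. -/
abbrev FPGrp (Γ : LabGraph (Σ i, S i)) :=
  CoprodI M ⧸ Subgroup.normalClosure (fpRels M S σ Γ)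

/-- Evaluation of a word in `G(Γ)`. -/
def fpEval (Γ : LabGraph (Σ i, S i)) (w : Word (Σ i, S i)) : FPGrp M S σ Γ :=
  QuotientGroup.mk (evalFPWord M S σ w)

/-- The canonical map of a factor into `G(Γ)`. -/
def fpOf (Γ : LabGraph (Σ i, S i)) {i : ι} (x : M i) : FPGrp M S σ Γ :=
  QuotientGroup.mk (CoprodI.of x)

/-- The canonical generators of `G(Γ)`. -/
def fpGen (Γ : LabGraph (Σ i, S i)) : (Σ i, S i) → FPGrp M S σ Γ :=
  fun x => fpEval M S σ Γ [(x, true)]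

/-- The canonical generators of `G_n(Γ)`. -/
def fpGenN (Γ : LabGraph (Σ i, S i)) (n : ℕ) :
    (Σ i, S i) → BurnsideQuotient (FPGrp M S σ Γ) n :=
  fun x => QuotientGroup.mk (fpGen M S σ Γ x)

/-- The generating set of the cone-off space in the free product case. -/
def fpConeGens (Γ : LabGraph (Σ i, S i)) : Set (FPGrp M S σ Γ) :=
  Set.range (fpGen M S σ Γ) ∪
    { g | ∃ p, Γ.IsPath p ∧ g = fpEval M S σ Γ (Γ.wordOf p) }

/-- The metric of the cone-off space in the free product case. -/
def fpConeDist (Γ : LabGraph (Σ i, S i)) :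
    FPGrp M S σ Γ → FPGrp M S σ Γ → ℝ :=
  wordDist (fpConeGens M S σ Γ)

/-- A word is locally geodesic: it labels a geodesic of the Cayley graph of the free
product. -/
def LocallyGeodesic (w : Word (Σ i, S i)) : Prop :=
  ∀ w' : Word (Σ i, S i), evalFPWord M S σ w' = evalFPWord M S σ w →
    w.length ≤ w'.length

/-- The Cayley graph of the factor `M i`, as a graph labelled by `Σ j, S j`. -/
def FactorCayley (i : ι) : LabGraph (Σ j, S j) :=
  (CayleyGraph (M i) (S i) (σ i)).relabel fun s => ⟨i, s⟩

/-- An attached Cayley graph: an embedded copy of the Cayley graph of a factor,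
saturated for edges labelled in that factor. -/
def IsAttachedCayley {Γ : LabGraph (Σ i, S i)} (i : ι)
    (f : LabGraph.Hom (FactorCayley M S σ i) Γ) : Prop :=
  Function.Injective f.vmap ∧ Function.Injective f.emap ∧
  ∀ e : Γ.E, (Γ.label e).1.1 = i → (∃ v, f.vmap v = Γ.init e) → ∃ e', f.emap e' = e

/-- `Γ` coincides with its completion and all attached Cayley graphs are embedded. -/
def IsCompleted (Γ : LabGraph (Σ i, S i)) : Prop :=
  (∀ i, ∃ f : LabGraph.Hom (FactorCayley M S σ i) Γ, IsAttachedCayley M S σ i f) ∧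
  (∀ (i : ι) (v : Γ.V), (∃ e, Γ.init e = v ∧ (Γ.label e).1.1 = i) →
    ∃ f : LabGraph.Hom (FactorCayley M S σ i) Γ,
      IsAttachedCayley M S σ i f ∧ v ∈ Set.range f.vmap)

/-- The graphical `C'_*(λ)`-condition over a free product. -/
def FPSC (Γ : LabGraph (Σ i, S i)) (lam : ℝ) : Prop :=
  IsCompleted M S σ Γ ∧
  ∀ γ, Γ.IsSimpleClosedPath γ → evalFPWord M S σ (Γ.wordOf γ) ≠ 1 →
    ∀ w, Γ.IsPiece w → LocallyGeodesic M S σ w → Γ.OccursOn w γ →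
      (w.length : ℝ) < lam * (γ.length : ℝ)

/-- Cylinder-freeness: no nontrivial label-preserving automorphism of a component
preserves two disjoint attached Cayley graphs. -/
def CylinderFree (Γ : LabGraph (Σ i, S i)) : Prop :=
  ∀ (v₀ : Γ.V) (i₁ i₂ : ι)
    (f₁ : LabGraph.Hom (FactorCayley M S σ i₁) (Γ.component v₀))
    (f₂ : LabGraph.Hom (FactorCayley M S σ i₂) (Γ.component v₀)),
    IsAttachedCayley M S σ i₁ f₁ → IsAttachedCayley M S σ i₂ f₂ →
    Disjoint (Set.range f₁.vmap) (Set.range f₂.vmap) →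
    ∀ φ : (Γ.component v₀).Aut,
      ⇑φ.vmap '' Set.range f₁.vmap = Set.range f₁.vmap →
      ⇑φ.vmap '' Set.range f₂.vmap = Set.range f₂.vmap →
      IsAutId φ

/-- The graphical `C'_*(λ, p)`-condition over a free product. -/
def FPSCP (Γ : LabGraph (Σ i, S i)) (lam : ℝ) (p : ℕ) : Prop :=
  FPSC M S σ Γ lam ∧ CylinderFree M S σ Γ ∧
  ∀ w : Word (Σ i, S i), Word.IsCyclicallyReduced w → Γ.LabelsPath (Word.pow w p) →
    ∀ k : ℕ, Γ.LabelsPath (Word.pow w k)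

end FPGraphical

/-! ## Finite presentations relative to the Burnside variety, and decision problems -/

/-- Code for a finite presentation relative to the Burnside variety: a number of
generators and a finite list of relator words. -/
abbrev BPres : Type := ℕ × List (List (ℕ × Bool))

/-- The relations determined by such a code: the listed relators, the generators beyond
the prescribed ones, and all `n`-th powers. -/
def presRels (n : ℕ) (P : BPres) : Set (FreeGroup ℕ) :=
  { g | ∃ w ∈ P.2, g = FreeGroup.mk w } ∪
  { g | ∃ m : ℕ, P.1 ≤ m ∧ g = FreeGroup.of m } ∪
  { g | ∃ x : FreeGroup ℕ, g = x ^ n }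

/-- The `n`-periodic group presented by a code. -/
abbrev presGroup (n : ℕ) (P : BPres) : Type :=
  FreeGroup ℕ ⧸ Subgroup.normalClosure (presRels n P)

/-- `G` is finitely presented relative to the Burnside variety `B_n`. -/
def FinPresRelBurnside (n : ℕ) (G : Type v) [Group G] : Prop :=
  ∃ (S : Type) (R : Set (FreeGroup S)), Finite S ∧ R.Finite ∧
    Nonempty (G ≃* (FreeGroup S ⧸
      Subgroup.normalClosure (R ∪ { g : FreeGroup S | ∃ x : FreeGroup S, g = x ^ n })))

/-! ## Expanders and property A -/

/-- Number of edges from `A` to its complement. -/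
def edgeBoundaryCard {V : Type v} (G : SimpleGraph V) (A : Set V) : ℕ :=
  Set.ncard { p : V × V | p.1 ∈ A ∧ p.2 ∉ A ∧ G.Adj p.1 p.2 }

/-- An expander family: finite graphs of uniformly bounded valency, of sizes tending to
infinity, with Cheeger constants uniformly bounded away from `0`. -/
def IsExpanderFamily (V : ℕ → Type) (G : ∀ k, SimpleGraph (V k)) : Prop :=
  (∀ k, Finite (V k)) ∧
  (∃ D : ℕ, ∀ (k : ℕ) (v : V k), Set.ncard { u | (G k).Adj v u } ≤ D) ∧
  Filter.Tendsto (fun k => Nat.card (V k)) Filter.atTop Filter.atTop ∧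
  ∃ c : ℝ, 0 < c ∧ ∀ (k : ℕ) (A : Set (V k)), A.Nonempty →
    2 * A.ncard ≤ Nat.card (V k) →
    c * (A.ncard : ℝ) ≤ (edgeBoundaryCard (G k) A : ℝ)

/-- Diameter of a simple graph (as a real number). -/
def sgDiam {V : Type v} (G : SimpleGraph V) : ℝ :=
  sSup { r : ℝ | ∃ u v, r = (G.dist u v : ℝ) }

/-- The box-space metric on the disjoint union of a family of finite graphs. -/
def expBoxDist (V : ℕ → Type) (G : ∀ k, SimpleGraph (V k)) (x y : Σ k, V k) : ℝ :=
  if h : x.1 = y.1 then ((G y.1).dist (h ▸ x.2) y.2 : ℝ)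
  else sgDiam (G x.1) + sgDiam (G y.1) + (x.1 : ℝ) + (y.1 : ℝ)

/-- Yu's property A for a group endowed with the word metric of a generating set. -/
def HasPropertyA {Q : Type v} [Group Q] (A : Set Q) : Prop :=
  ∀ R ε : ℝ, 0 < ε → ∃ (B : Q → Set (Q × ℕ)) (Sb : ℝ),
    (∀ g, (B g).Finite ∧ (B g).Nonempty) ∧
    (∀ g h : Q, wordDist A g h ≤ R →
      ((symmDiff (B g) (B h)).ncard : ℝ) ≤ ε * ((B g ∩ B h).ncard : ℝ)) ∧
    ∀ g : Q, ∀ x ∈ B g, wordDist A g x.1 ≤ Sb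

end

/-! ## Translation lengths in hyperbolic spaces -/

/-- The four point inequality, in terms of sums of opposite distances. -/
theorem IsHyperbolicDist.dist_add_dist_le {X : Type*} [MetricSpace X] {δ : ℝ}
    (hhyp : IsHyperbolicDist (fun x y : X => dist x y) δ) (x y z t : X) :
    dist x z + dist y t ≤ dist x y + dist z t + 2 * δ ∨
      dist x z + dist y t ≤ dist y z + dist x t + 2 * δ := by
  have h := hhyp x y z t
  simp only [gromovProd] at h
  rcases min_cases ((dist x t + dist y t - dist x y) / 2)
    ((dist y t + dist z t - dist y z) / 2) with ⟨h', _⟩ | ⟨h', _⟩ <;> rw [h'] at h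
  · left; linarith
  · right; linarith

/-- If the square of an isometry displaces a point sufficiently more than the isometry itself,
then the displacements of its powers grow linearly. -/
theorem IsHyperbolicDist.dist_pow_smul_growth {X G : Type*} [MetricSpace X] [Group G]
    [MulAction G X] (hiso : ∀ g : G, Isometry fun x : X => g • x) {δ : ℝ} (hδ : 0 ≤ δ)
    (hhyp : IsHyperbolicDist (fun x y : X => dist x y) δ) (u : G) (p : X) {c : ℝ} (hc : 0 < c)
    (hcu : dist (u • p) p + 2 * δ + c ≤ dist (u ^ 2 • p) p) (n : ℕ) :
    dist (u ^ (n + 1) • p) p + c ≤ dist (u ^ (n + 2) • p) p := by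
  induction n with
  | zero => simpa using by linarith
  | succ n ih =>
    have shift (i j : ℕ) : dist (u ^ (i + j) • p) (u ^ i • p) = dist (u ^ j • p) p := by
      rw [pow_add, mul_smul]
      exact (hiso (u ^ i)).dist_eq _ _
    have h1 := shift 1 1
    have h2 := shift 1 (n + 2)
    have h3 := shift 2 (n + 1)
    rw [show 1 + (n + 2) = n + 3 by ring] at h2
    rw [show 2 + (n + 1) = n + 3 by ring] at h3
    simp only [pow_one, Nat.reduceAdd] at h1 h2
    rw [show n + 1 + 1 = n + 2 by ring, show n + 1 + 2 = n + 3 by ring]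
    have h := hhyp.dist_add_dist_le p (u • p) (u ^ 2 • p) (u ^ (n + 3) • p)
    simp only [dist_comm p, dist_comm (u • p) (u ^ (n + 3) • p),
      dist_comm (u • p) (u ^ 2 • p), dist_comm (u ^ 2 • p) (u ^ (n + 3) • p)] at h
    rcases h with h | h <;> linarith

/-- The displacement of a point by `g ^ 2k` exceeds the displacement by `g ^ k` by at most
the asymptotic translation length of `g ^ k`, up to a bounded error. -/
theorem IsHyperbolicDist.dist_sq_smul_le {X G : Type*} [MetricSpace X] [Group G]
    [MulAction G X] (hiso : ∀ g : G, Isometry fun x : X => g • x) {δ : ℝ} (hδ : 0 ≤ δ)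
    (hhyp : IsHyperbolicDist (fun x y : X => dist x y) δ) (g : G) (x p : X) {l : ℝ}
    (hl : Filter.Tendsto (fun k : ℕ => dist ((g ^ k) • x) x / (k : ℝ)) Filter.atTop (nhds l))
    {k : ℕ} (hk : 0 < k) :
    dist ((g ^ k) ^ 2 • p) p ≤ dist (g ^ k • p) p + k * l + 2 * δ := by
  have hk' : (0 : ℝ) < k := by exact_mod_cast hk
  by_contra! hlt
  have hl0 : 0 ≤ l := ge_of_tendsto' hl fun n => by positivity
  set c := dist ((g ^ k) ^ 2 • p) p - dist (g ^ k • p) p - 2 * δ with hc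
  have hcl : k * l < c := by linarith
  have hc0 : 0 < c := lt_of_le_of_lt (by positivity) hcl
  have hgrow := hhyp.dist_pow_smul_growth hiso hδ (g ^ k) p hc0 (by linarith)
  have hlin (n : ℕ) : n * c ≤ dist ((g ^ k) ^ (n + 1) • p) p := by
    induction n with
    | zero => simp
    | succ n ih =>
      have := hgrow n
      push_cast
      linarith
  have hbound (n : ℕ) : n * c - 2 * dist x p ≤ dist (g ^ (k * (n + 1)) • x) x := by
    have h1 := hlin n
    rw [← pow_mul] at h1
    have h2 := dist_triangle4 (g ^ (k * (n + 1)) • p) (g ^ (k * (n + 1)) • x) x p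
    rw [(hiso (g ^ (k * (n + 1)))).dist_eq, dist_comm p x] at h2
    linarith
  have hsub : Filter.Tendsto (fun n : ℕ => k * (n + 1)) Filter.atTop Filter.atTop :=
    Filter.tendsto_atTop_mono (fun n => by simp only [id]; nlinarith) Filter.tendsto_id
  have hlim1 := (hl.comp hsub).const_mul (k : ℝ)
  have hlim2 : Filter.Tendsto (fun n : ℕ => c - (c + 2 * dist x p) / ((n : ℝ) + 1))
      Filter.atTop (nhds c) := by
    have h := (tendsto_one_div_add_atTop_nhds_zero_nat (𝕜 := ℝ)).const_mul (c + 2 * dist x p)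
    simpa [div_eq_mul_inv] using h.const_sub c
  refine hcl.not_ge (le_of_tendsto_of_tendsto' hlim2 hlim1 fun n => ?_)
  have hn : (0 : ℝ) < (n : ℝ) + 1 := by positivity
  simp only [Function.comp_apply]
  push_cast
  have h1 : c - (c + 2 * dist x p) / ((n : ℝ) + 1) = (n * c - 2 * dist x p) / (n + 1) := by
    field_simp
    ring
  have h2 : (k : ℝ) * (dist (g ^ (k * (n + 1)) • x) x / (k * ((n : ℝ) + 1))) =
      dist (g ^ (k * (n + 1)) • x) x / (n + 1) := by
    field_simp
  rw [h1, h2]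
  gcongr
  exact hbound n

/-- An isometry moving two far apart points by a bounded amount almost translates their midpoint
along a line. -/
theorem IsHyperbolicDist.two_mul_dist_smul_le {X G : Type*} [MetricSpace X] [Group G]
    [MulAction G X] (hiso : ∀ g : G, Isometry fun x : X => g • x) {δ : ℝ} (hδ : 0 ≤ δ)
    (hhyp : IsHyperbolicDist (fun x y : X => dist x y) δ) (u : G) (a b p : X) {K : ℝ}
    (hap : dist a p ≤ dist a b / 2 + δ) (hpb : dist p b ≤ dist a b / 2 + δ)
    (ha : dist a (u • a) ≤ K) (hb : dist b (u • b) ≤ K)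
    (hD : 2 * K + 8 * δ < dist a b) :
    2 * dist (u • p) p ≤ dist (u ^ 2 • p) p + 10 * δ := by
  have htri := dist_triangle a p b
  have hiu (y z : X) : dist (u • y) (u • z) = dist y z := (hiso u).dist_eq y z
  have hsq : dist (u ^ 2 • p) (u • p) = dist (u • p) p := by
    rw [sq, mul_smul, hiu]
  have hmove : dist (u • p) p ≤ max (dist a (u • p)) (dist b (u • p)) - dist a b / 2 + 3 * δ := by
    have h := hhyp.dist_add_dist_le a p b (u • p)
    rw [dist_comm p (u • p)] at h
    have := le_max_left (dist a (u • p)) (dist b (u • p))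
    have := le_max_right (dist a (u • p)) (dist b (u • p))
    rcases h with h | h <;> linarith
  have hdir (e : X) (he : dist e (u • e) ≤ K) (hep : dist e p ≤ dist a b / 2 + δ)
      (hep' : dist a b / 2 - δ ≤ dist e p)
      (hm : dist (u • p) p ≤ dist e (u • p) - dist a b / 2 + 3 * δ) :
      2 * dist (u • p) p ≤ dist (u ^ 2 • p) p + 10 * δ := by
    have hep1 := hiu e p
    have h1 := dist_triangle e (u • e) (u • p)
    have h := hhyp.dist_add_dist_le e (u • e) (u • p) p
    have h3 := dist_triangle (u • e) p (u ^ 2 • p)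
    have h4 : dist (u • e) (u ^ 2 • p) = dist e (u • p) := by rw [sq, mul_smul, hiu]
    rw [dist_comm p (u ^ 2 • p)] at h3
    rcases h with h | h
    · have h5 := dist_triangle e (u • e) p
      have h6 := hhyp.dist_add_dist_le e (u • e) p (u • p)
      rw [dist_comm p (u • p)] at h6
      rcases h6 with h6 | h6 <;> linarith
    · linarith
  rcases max_cases (dist a (u • p)) (dist b (u • p)) with ⟨h, _⟩ | ⟨h, _⟩ <;> rw [h] at hmove
  · exact hdir a ha hap (by linarith) hmove
  · rw [dist_comm p b] at hpb htri
    exact hdir b hb hpb (by linarith) hmove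

/-- Lemma 3.6, after Bowditch / `res: lower bound inj radius`.
For a `(100δ, L, N)`-acylindrical isometric action on a `δ`-hyperbolic length space,
the asymptotic translation length of every loxodromic element is at least `δ/N`. -/
theorem injectivity_radius_lower_bound (δ L : ℝ) (N : ℕ)
    (hδ : 0 < δ) (hL : 0 < L) (hN : 0 < N)
    (X : Type) [MetricSpace X] (G : Type) [Group G] [MulAction G X]
    (hiso : ∀ g : G, Isometry fun x : X => g • x)
    (hhyp : IsHyperbolicDist (fun x y : X => dist x y) δ)
    (hlen : IsLengthDist (fun x y : X => dist x y))
    (hacyl : AcylindricalOn (fun x y : X => dist x y)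
      (fun (g : G) (x : X) => g • x) (100 * δ) L N) :
    ∀ g : G, LoxodromicElt (fun x y : X => dist x y)
        (fun (g : G) (x : X) => g • x) g →
      ∀ (x : X) (l : ℝ),
        Filter.Tendsto (fun k : ℕ => dist ((g ^ k) • x) x / (k : ℝ))
          Filter.atTop (nhds l) →
        δ / (N : ℝ) ≤ l := by
  intro g hg x l hl
  by_contra! hlt
  obtain ⟨o, lam, c, hlam, hc, hqi⟩ := hg
  have hN' : (0 : ℝ) < N := by exact_mod_cast hN
  have hNl : N * l < δ := by rw [lt_div_iff₀ hN'] at hlt; linarith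
  have hl0 : 0 ≤ l := ge_of_tendsto' hl fun n => by positivity
  have hdist (h : G) (y z : X) : dist (h • y) (h • z) = dist y z := (hiso h).dist_eq y z
  have hcomm (m n : ℤ) (y : X) : dist (g ^ m • g ^ n • y) (g ^ n • y) = dist (g ^ m • y) y := by
    rw [← mul_smul, (Commute.refl g).zpow_zpow m n |>.eq, mul_smul, hdist]
  have hfar (R : ℝ) : ∃ M : ℕ, ∀ m n : ℤ, (M : ℝ) ≤ (m : ℝ) - n →
      R < dist (g ^ m • o) (g ^ n • o) := by
    obtain ⟨M, hM⟩ := exists_nat_gt (lam * (R + c))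
    refine ⟨M, fun m n hmn => ?_⟩
    have h1 := (hqi m n).1
    have h2 : R + c < lam⁻¹ * |(m : ℝ) - n| := by
      rw [inv_mul_eq_div, lt_div_iff₀ hlam]
      linarith [le_abs_self ((m : ℝ) - n)]
    simp only at h1
    linarith
  have hinj : Function.Injective fun k : ℕ => g ^ k := by
    refine injective_pow_iff_not_isOfFinOrder.mpr fun hfin => ?_
    obtain ⟨n, hn, hgn⟩ := isOfFinOrder_iff_pow_eq_one.mp hfin
    obtain ⟨M, hM⟩ := hfar 0
    have h := hM (n * M : ℕ) 0 (by
      have hle : M ≤ n * M := Nat.le_mul_of_pos_left M hn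
      have : (M : ℝ) ≤ (n * M : ℕ) := by exact_mod_cast hle
      simpa using this)
    rw [zpow_natCast, pow_mul, hgn] at h
    simp at h
  have hsmall (k : ℕ) : dist (g ^ k • o) o ≤ k * dist (g • o) o := by
    induction k with
    | zero => simp
    | succ k ih =>
      have h := dist_triangle (g ^ (k + 1) • o) (g ^ k • o) o
      rw [pow_succ, mul_smul, hdist] at h
      rw [pow_succ, mul_smul]
      push_cast
      linarith
  set K := N * dist (g • o) o with hK
  obtain ⟨M, hM⟩ := hfar (2 * K + 8 * δ)
  set a := g ^ (M : ℤ) • o with ha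
  have hab : 2 * K + 8 * δ < dist a o := by
    simpa [ha] using hM M 0 (by simp)
  obtain ⟨p, hp1, hp2⟩ := hlen a o δ hδ
  have hp (k : ℕ) (hk : k ≤ N) : dist (g ^ k • p) p ≤ 100 * δ := by
    rcases Nat.eq_zero_or_pos k with rfl | hk0
    · simp only [pow_zero, one_smul, dist_self]; positivity
    have hkN : (k : ℝ) ≤ N := by exact_mod_cast hk
    have hoK : dist (g ^ k • o) o ≤ K :=
      (hsmall k).trans (mul_le_mul_of_nonneg_right hkN dist_nonneg)
    have haK : dist (g ^ k • a) a ≤ K := by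
      have := hcomm k M o
      rw [zpow_natCast] at this
      rw [ha, this]
      exact hoK
    have h1 := hhyp.two_mul_dist_smul_le hiso hδ.le (g ^ k) a o p hp1 hp2
      (by rwa [dist_comm]) (by rwa [dist_comm]) hab
    have h2 := hhyp.dist_sq_smul_le hiso hδ.le g x p hl hk0
    have h3 : k * l ≤ N * l := mul_le_mul_of_nonneg_right hkN hl0
    linarith
  obtain ⟨M', hM'⟩ := hfar (L + 2 * dist p o)
  have hLq : L ≤ dist p (g ^ (M' : ℤ) • p) := by
    have h1 := hM' M' 0 (by simp)
    have h2 := dist_triangle4 (g ^ (M' : ℤ) • o) (g ^ (M' : ℤ) • p) p o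
    rw [hdist, dist_comm o p, dist_comm _ p] at h2
    simp only [zpow_zero, one_smul] at h1
    linarith
  obtain ⟨hfin, hcard⟩ := hacyl p (g ^ (M' : ℤ) • p) hLq
  have hsub : (fun k : ℕ => g ^ k) '' Set.Iic N ⊆
      { u : G | dist (u • p) p ≤ 100 * δ ∧
        dist (u • g ^ (M' : ℤ) • p) (g ^ (M' : ℤ) • p) ≤ 100 * δ } := by
    rintro _ ⟨k, hk, rfl⟩
    refine ⟨hp k hk, ?_⟩
    have := hcomm k M' p
    rw [zpow_natCast g k] at this
    simp only [this]
    exact hp k hk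
  have h := (Set.ncard_le_ncard hsub hfin).trans hcard
  rw [Set.ncard_image_of_injective _ hinj, Set.ncard_eq_toFinset_card', Set.toFinset_Iic,
    Nat.card_Iic] at h
  omega
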